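/- For all abelian groups A, B and every group homomorphism r : B → A, the maps s_n : C^n → C^{n−1} (n ≥ 2) defined by s_n(φ_1, φ_2, φ_3, …, φ_n, ψ) = (−φ_1, φ_3, φ_4, …, φ_n, ψ) form a contracting homotopy in degrees ≥ 2 for the character complex: for every n ≥ 2 one has d^{n−1} ∘ s_n + s_{n+1} ∘ d^n = id_{C^n}. (This is the homotopy constructed in the proof of Lemma 3.4 of the paper, following Sansuc.) -/

import Mathlib

/-- The coface maps `δ_i^* : Cⁿ → Cⁿ⁺¹` of the character complex associated to
abelian groups `A`, `B` and a homomorphism `r : B → A`, where `Cⁿ = Aⁿ ⊕ B`: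
`δ_0^* (φ₁,…,φₙ,ψ) = (r ψ, φ₁,…,φₙ, ψ)`;
`δ_i^* (φ₁,…,φₙ,ψ) = (φ₁,…,φ_{i-1}, φ_i, φ_i, φ_{i+1},…,φₙ, ψ)` for `1 ≤ i ≤ n`;
`δ_{n+1}^* (φ₁,…,φₙ,ψ) = (φ₁,…,φₙ, 0, ψ)`. -/
def deltaStar {A B : Type*} [AddCommGroup A] [AddCommGroup B] (r : B →+ A)
    (n i : ℕ) (p : (Fin n → A) × B) : (Fin (n + 1) → A) × B :=
  if h0 : i = 0 then
    (Fin.cons (r p.2) p.1, p.2)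
  else if hi : i ≤ n then
    ((fun k : Fin (n + 1) =>
        if hk : (k : ℕ) < i then p.1 ⟨(k : ℕ), lt_of_lt_of_le hk hi⟩
        else p.1 ⟨(k : ℕ) - 1, by have := k.isLt; omega⟩), p.2)
  else
    (Fin.snoc p.1 0, p.2)

/-- The differential `dⁿ = Σ_{i=0}^{n+1} (−1)^i δ_i^* : Cⁿ → Cⁿ⁺¹`
of the character complex. -/
def charD {A B : Type*} [AddCommGroup A] [AddCommGroup B] (r : B →+ A) (n : ℕ)
    (p : (Fin n → A) × B) : (Fin (n + 1) → A) × B :=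
  ∑ i ∈ Finset.range (n + 2), (-1 : ℤ) ^ i • deltaStar r n i p

/-- The contracting homotopy `s_n : Cⁿ → Cⁿ⁻¹` (for `n = m + 2 ≥ 2`):
`s_n (φ₁, φ₂, φ₃, …, φₙ, ψ) = (−φ₁, φ₃, φ₄, …, φₙ, ψ)`. -/
def charS {A B : Type*} [AddCommGroup A] [AddCommGroup B] (m : ℕ)
    (p : (Fin (m + 2) → A) × B) : (Fin (m + 1) → A) × B :=
  (Fin.cons (-(p.1 0)) (fun k : Fin m => p.1 k.succ.succ), p.2)

/-- The sequence `r ψ, φ₁, …, φₙ, 0, 0, …` attached to `(φ₁,…,φₙ,ψ)`. -/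
def charExtend {A B : Type*} [AddCommGroup A] [AddCommGroup B] (r : B →+ A) {n : ℕ}
    (p : (Fin n → A) × B) : ℕ → A
  | 0 => r p.2
  | j + 1 => if h : j < n then p.1 ⟨j, h⟩ else 0

theorem deltaStar_snd {A B : Type*} [AddCommGroup A] [AddCommGroup B] (r : B →+ A)
    (n i : ℕ) (p : (Fin n → A) × B) : (deltaStar r n i p).2 = p.2 := by
  unfold deltaStar
  split_ifs <;> rfl

theorem deltaStar_fst_apply {A B : Type*} [AddCommGroup A] [AddCommGroup B] (r : B →+ A)
    {n i : ℕ} (hi : i ≤ n + 1) (p : (Fin n → A) × B) (k : Fin (n + 1)) :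
    (deltaStar r n i p).1 k =
      if (k : ℕ) < i then charExtend r p (k + 1) else charExtend r p k := by
  obtain ⟨k, hk⟩ := k
  unfold deltaStar
  split_ifs with h0 h1 h2 h3 h4
  · simp at h1
    omega
  · cases k with
    | zero => rfl
    | succ k =>
      have hkn : k < n := by omega
      simp only [charExtend, hkn, dite_true]
      exact Fin.cons_succ (α := fun _ => A) (r p.2) p.1 ⟨k, hkn⟩
  · have hkn : k < n := by simp at h3; omega
    simp_all [charExtend]
  · cases k with
    | zero => simp at h3; omega
    | succ k =>
      have hkn : k < n := by omega
      have hki : ¬ k + 1 < i := h3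
      simp [charExtend, hkn, hki]
  · by_cases hkn : k < n <;> simp [charExtend, Fin.snoc, hkn]
  · simp at *
    omega

theorem sum_range_neg_one_pow_smul {A : Type*} [AddCommGroup A] (x : A) (N : ℕ) :
    ∑ i ∈ Finset.range N, (-1 : ℤ) ^ i • x = if Even N then 0 else x := by
  rw [← Finset.sum_smul, neg_one_geom_sum]
  split_ifs <;> simp

theorem sum_range_neg_one_pow_smul_ite {A : Type*} [AddCommGroup A] (x y : A) {k N : ℕ}
    (hk : k < N) :
    ∑ i ∈ Finset.range N, (-1 : ℤ) ^ i • (if k < i then x else y) =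
      (if Even k then y - x else 0) + if Even N then 0 else x := by
  induction N, hk using Nat.le_induction with
  | base =>
    have h : ∀ i ∈ Finset.range (k + 1),
        (-1 : ℤ) ^ i • (if k < i then x else y) = (-1 : ℤ) ^ i • y := by
      intro i hi
      rw [if_neg (by simpa [Nat.lt_succ_iff] using hi)]
    rw [Finset.sum_congr rfl h, sum_range_neg_one_pow_smul]
    by_cases hke : Even k <;> simp [hke, Nat.even_add_one]
  | succ N hN ih =>
    rw [Finset.sum_range_succ, ih, if_pos (by omega : k < N)]
    by_cases hNe : Even N
    · simp [hNe, Nat.even_add_one]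
    · simp [hNe, Nat.even_add_one, (Nat.not_even_iff_odd.mp hNe).neg_one_pow]

theorem charD_snd {A B : Type*} [AddCommGroup A] [AddCommGroup B] (r : B →+ A) (n : ℕ)
    (p : (Fin n → A) × B) : (charD r n p).2 = if Even n then 0 else p.2 := by
  simp only [charD, Prod.snd_sum, Prod.smul_snd, deltaStar_snd, sum_range_neg_one_pow_smul]
  simp [Nat.even_add]

theorem charD_fst_apply {A B : Type*} [AddCommGroup A] [AddCommGroup B] (r : B →+ A) (n : ℕ)
    (p : (Fin n → A) × B) (k : Fin (n + 1)) :
    (charD r n p).1 k =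
      (if Even (k : ℕ) then charExtend r p k - charExtend r p (k + 1) else 0) +
        if Even n then 0 else charExtend r p (k + 1) := by
  have h : ∀ i ∈ Finset.range (n + 2), (-1 : ℤ) ^ i • (deltaStar r n i p).1 k =
      (-1 : ℤ) ^ i •
        (if (k : ℕ) < i then charExtend r p (k + 1) else charExtend r p k) := by
    intro i hi
    rw [deltaStar_fst_apply r (by simpa [Nat.lt_succ_iff] using hi)]
  simp only [charD, Prod.fst_sum, Finset.sum_apply, Prod.smul_fst, Pi.smul_apply]
  rw [Finset.sum_congr rfl h, sum_range_neg_one_pow_smul_ite _ _ (by omega)]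
  simp [Nat.even_add]

/-- For all abelian groups `A`, `B` and every group homomorphism `r : B → A`, the maps
`s_n : Cⁿ → Cⁿ⁻¹` (`n ≥ 2`, here `n = m + 2`) defined by
`s_n (φ₁, φ₂, φ₃, …, φₙ, ψ) = (−φ₁, φ₃, φ₄, …, φₙ, ψ)` form a contracting homotopy in
degrees `≥ 2` for the character complex: for every `n ≥ 2` one has
`dⁿ⁻¹ ∘ s_n + s_{n+1} ∘ dⁿ = id_{Cⁿ}`. -/
theorem charS_homotopy {A B : Type*} [AddCommGroup A] [AddCommGroup B] (r : B →+ A)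
    (m : ℕ) (p : (Fin (m + 2) → A) × B) :
    charD r (m + 1) (charS m p) + charS (m + 1) (charD r (m + 2) p) = p := by
  refine Prod.ext (funext fun k => ?_) ?_
  · obtain ⟨k, hk⟩ := k
    rw [Prod.fst_add, Pi.add_apply, charD_fst_apply]
    rcases k with _ | k
    · have hs : (charS (m + 1) (charD r (m + 2) p)).1 ⟨0, hk⟩ =
          -(charD r (m + 2) p).1 0 := rfl
      rw [hs, charD_fst_apply]
      by_cases hm : Even m <;> simp [charExtend, charS, Nat.even_add, hm]
    · have hs : (charS (m + 1) (charD r (m + 2) p)).1 ⟨k + 1, hk⟩ =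
          (charD r (m + 2) p).1 ⟨k + 2, by omega⟩ := rfl
      rw [hs, charD_fst_apply]
      have hk' : k < m + 1 := by omega
      have hc : ∀ (j : ℕ) (hj : j + 1 < m + 1),
          (charS m p).1 ⟨j + 1, hj⟩ = p.1 ⟨j + 2, by omega⟩ := fun _ _ => rfl
      have hd : charExtend r (charS m p) (k + 2) = charExtend r p (k + 3) := by
        by_cases h : k < m <;> simp [charExtend, hc, h]
      have hp : charExtend r p (k + 2) = p.1 ⟨k + 1, hk⟩ := by
        simp [charExtend, hk']
      have ho : ¬ Even k → charExtend r (charS m p) (k + 1) = p.1 ⟨k + 1, hk⟩ := by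
        rcases k with _ | j
        · simp
        · simp [charExtend, hc, hk']
      simp only [add_assoc, Nat.reduceAdd, hd, hp]
      by_cases hm : Even m <;> by_cases hke : Even k <;>
        simp [Nat.even_add, hm, hke, ho]
  · have hs : (charS (m + 1) (charD r (m + 2) p)).2 = (charD r (m + 2) p).2 := rfl
    have hp : (charS m p).2 = p.2 := rfl
    rw [Prod.snd_add, hs, charD_snd, charD_snd, hp]
    by_cases hm : Even m <;> simp [Nat.even_add, hm]
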